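/- arXiv:math/0210261 — 6 statements merged into one kernel-verified Lean document; each statement's English description precedes it below -/
import Mathlib

section
/- Let 𝔤 be a finite-dimensional complex simple Lie algebra, 𝔥 ⊆ 𝔤 a Cartan subalgebra, Δ ⊆ Φ(𝔤,𝔥) a base of simple roots, and σ : 𝔤 → 𝔤 a conjugate-linear involution with σ(𝔥) = 𝔥 and σ*(Δ) = Δ. Let μ : Δ → Δ be the restriction of σ*. Then there exists a choice of elements e_α ∈ 𝔤_α and e_{−α} ∈ 𝔤_{−α} for α ∈ Δ with [e_α, e_{−α}] = h_α, such that σ(e_α) = e_{μ(α)} and σ(e_{−α}) = e_{−μ(α)} for all α ∈ Δ. -/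
open scoped BigOperators

/-- A conjugate-linear involutive Lie algebra automorphism of a complex Lie algebra. -/
def IsConjLinearInvolution {L : Type*} [LieRing L] [LieAlgebra ℂ L] (σ : L → L) : Prop :=
  (∀ x y : L, σ (x + y) = σ x + σ y) ∧
  (∀ (z : ℂ) (x : L), σ (z • x) = (starRingEnd ℂ) z • σ x) ∧
  (∀ x y : L, σ ⁅x, y⁆ = ⁅σ x, σ y⁆) ∧
  (∀ x : L, σ (σ x) = x)

/-- `x` is a root vector for the functional `α` on the Cartan subalgebra `H`. -/
def IsRootVector {L : Type*} [LieRing L] [LieAlgebra ℂ L] (H : LieSubalgebra ℂ L)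
    (α : H → ℂ) (x : L) : Prop :=
  ∀ h : H, ⁅(h : L), x⁆ = α h • x

/-- `α` is a root of `(L, H)`: a nonzero functional admitting a nonzero root vector. -/
def IsRoot {L : Type*} [LieRing L] [LieAlgebra ℂ L] (H : LieSubalgebra ℂ L)
    (α : H → ℂ) : Prop :=
  α ≠ 0 ∧ ∃ x : L, x ≠ 0 ∧ IsRootVector H α x

/-- `Δ` is a base of simple roots for `(L, H)`: a linearly independent set of roots such
that every root is an integral combination of elements of `Δ` with coefficients that are
all nonnegative or all nonpositive. -/
def IsBase {L : Type*} [LieRing L] [LieAlgebra ℂ L] (H : LieSubalgebra ℂ L)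
    (Δ : Finset (H → ℂ)) : Prop :=
  (∀ α ∈ Δ, IsRoot H α) ∧
  (LinearIndependent ℂ (fun a : Δ => (a : H → ℂ))) ∧
  (∀ β : H → ℂ, IsRoot H β →
    ∃ c : (H → ℂ) → ℤ, ((∀ a ∈ Δ, 0 ≤ c a) ∨ (∀ a ∈ Δ, c a ≤ 0)) ∧
      β = ∑ a ∈ Δ, ((c a : ℂ) • a))

/-- The functional `σ*(α)`, given by `σ*(α)(h) = conj (α (σ h))`. -/
def sigmaStar {L : Type*} [LieRing L] [LieAlgebra ℂ L] (H : LieSubalgebra ℂ L)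
    (σ : L → L) (hH : ∀ x ∈ H, σ x ∈ H) (α : H → ℂ) : H → ℂ :=
  fun h => (starRingEnd ℂ) (α ⟨σ (h : L), hH (h : L) h.2⟩)

/-- `h` represents `α` via the Killing form: `h ∈ H` and `α(x) = κ(h, x)` for all `x ∈ H`. -/
def IsKillingDual {L : Type*} [LieRing L] [LieAlgebra ℂ L] (H : LieSubalgebra ℂ L)
    (h : L) (α : H → ℂ) : Prop :=
  h ∈ H ∧ ∀ x : H, α x = killingForm ℂ L h (x : L)

/-- An involution `μ` of an invariant set `S` lifts along a relation `P` that is compatible with an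
involution `T`, provided the fixed points of `μ` in `S` lift to fixed points of `T`. -/
lemma exists_equivariant_section {A X : Type*} {μ : A → A} {T : X → X} {S : Set A}
    {P : A → X → Prop} (hμ : Function.Involutive μ) (hT : Function.Involutive T)
    (hS : Set.MapsTo μ S S) (hP : ∀ a x, P a x → P (μ a) (T x))
    (hex : ∀ a ∈ S, ∃ x, P a x) (hfix : ∀ a ∈ S, μ a = a → ∃ x, P a x ∧ T x = x)
    (x₀ : X) :
    ∃ g : A → X, ∀ a ∈ S, P a (g a) ∧ T (g a) = g (μ a) := by
  classical
  let : LinearOrder A := linearOrderOfSTO WellOrderingRel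
  have hx : ∀ a, ∃ x, a ∈ S → P a x ∧ (μ a = a → T x = x) := by
    intro a
    by_cases ha : a ∈ S
    · by_cases hμa : μ a = a
      · obtain ⟨x, h₁, h₂⟩ := hfix a ha hμa
        exact ⟨x, fun _ ↦ ⟨h₁, fun _ ↦ h₂⟩⟩
      · obtain ⟨x, h⟩ := hex a ha
        exact ⟨x, fun _ ↦ ⟨h, fun h' ↦ absurd h' hμa⟩⟩
    · exact ⟨x₀, fun h ↦ absurd h ha⟩
  choose x hx using hx
  refine ⟨fun a ↦ if a ≤ μ a then x a else T (x (μ a)), fun a ha ↦ ?_⟩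
  rcases lt_trichotomy a (μ a) with h | h | h
  · simp [h.le, hμ a, h.not_ge, (hx a ha).1]
  · simp [← h, (hx a ha).1, (hx a ha).2 h.symm]
  · have h' := hP _ _ (hx (μ a) (hS ha)).1
    rw [hμ a] at h'
    simp [h.le, hμ a, h.not_ge, hT _, h']

section Semilinear

variable {L : Type*} [LieRing L] [LieAlgebra ℂ L] {σ : L → L}

namespace IsConjLinearInvolution

/-- The basis obtained by applying a conjugate-linear involution to a basis. -/
noncomputable def mapBasis (hσ : IsConjLinearInvolution σ) {ι : Type*} [Finite ι]
    (b : Module.Basis ι ℂ L) : Module.Basis ι ℂ L :=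
  .ofEquivFun
    { toFun := fun x i ↦ starRingEnd ℂ (b.equivFun (σ x) i)
      invFun := fun v ↦ σ (b.equivFun.symm fun i ↦ starRingEnd ℂ (v i))
      map_add' := fun x y ↦ by ext i; simp [hσ.1]
      map_smul' := fun z x ↦ by ext i; simp [hσ.2.1]
      left_inv := fun x ↦ by
        simp only [Complex.conj_conj]
        rw [LinearEquiv.symm_apply_apply, hσ.2.2.2]
      right_inv := fun v ↦ by
        ext i
        simp only [hσ.2.2.2, LinearEquiv.apply_symm_apply, Complex.conj_conj] }

lemma mapBasis_repr (hσ : IsConjLinearInvolution σ) {ι : Type*} [Finite ι]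
    (b : Module.Basis ι ℂ L) (x : L) (i : ι) :
    (hσ.mapBasis b).repr x i = starRingEnd ℂ (b.repr (σ x) i) := rfl

lemma mapBasis_apply (hσ : IsConjLinearInvolution σ) {ι : Type*} [Finite ι]
    (b : Module.Basis ι ℂ L) (i : ι) : hσ.mapBasis b i = σ (b i) := by
  classical
  apply (hσ.mapBasis b).repr.injective
  ext j
  rw [Module.Basis.repr_self, mapBasis_repr, hσ.2.2.2, Module.Basis.repr_self]
  simp [Finsupp.single_apply, apply_ite]

lemma trace_eq_conj [FiniteDimensional ℂ L] (hσ : IsConjLinearInvolution σ)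
    {f g : Module.End ℂ L} (h : ∀ x, g (σ x) = σ (f x)) :
    LinearMap.trace ℂ L g = starRingEnd ℂ (LinearMap.trace ℂ L f) := by
  classical
  let b := Module.finBasis ℂ L
  rw [LinearMap.trace_eq_matrix_trace ℂ (hσ.mapBasis b) g, LinearMap.trace_eq_matrix_trace ℂ b f,
    Matrix.trace, Matrix.trace, map_sum]
  refine Finset.sum_congr rfl fun i _ ↦ ?_
  rw [Matrix.diag_apply, Matrix.diag_apply, LinearMap.toMatrix_apply, LinearMap.toMatrix_apply,
    mapBasis_repr, mapBasis_apply, h, hσ.2.2.2]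

lemma killingForm_apply [FiniteDimensional ℂ L] (hσ : IsConjLinearInvolution σ) (x y : L) :
    killingForm ℂ L (σ x) (σ y) = starRingEnd ℂ (killingForm ℂ L x y) := by
  simp only [LieModule.traceForm_apply_apply]
  exact hσ.trace_eq_conj fun z ↦ by simp [hσ.2.2.1]

variable {H : LieSubalgebra ℂ L}

lemma sigmaStar_involutive (hσ : IsConjLinearInvolution σ) (hH : ∀ x ∈ H, σ x ∈ H) :
    Function.Involutive (sigmaStar H σ hH) := by
  intro α
  ext h
  simp [sigmaStar, hσ.2.2.2]

lemma sigmaStar_neg (hH : ∀ x ∈ H, σ x ∈ H) (α : H → ℂ) :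
    sigmaStar H σ hH (-α) = -sigmaStar H σ hH α := by
  ext h
  simp [sigmaStar]

lemma isRootVector (hσ : IsConjLinearInvolution σ) (hH : ∀ x ∈ H, σ x ∈ H) {α : H → ℂ} {x : L}
    (hx : IsRootVector H α x) : IsRootVector H (sigmaStar H σ hH α) (σ x) := by
  intro h
  rw [sigmaStar, ← hσ.2.1, ← hx, hσ.2.2.1, hσ.2.2.2]

lemma isKillingDual [FiniteDimensional ℂ L] (hσ : IsConjLinearInvolution σ)
    (hH : ∀ x ∈ H, σ x ∈ H) {α : H → ℂ} {x : L} (hx : IsKillingDual H x α) :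
    IsKillingDual H (σ x) (sigmaStar H σ hH α) := by
  refine ⟨hH x hx.1, fun h ↦ ?_⟩
  rw [sigmaStar, hx.2, ← hσ.killingForm_apply, hσ.2.2.2]

lemma map_ne_zero (hσ : IsConjLinearInvolution σ) {x : L} (hx : x ≠ 0) : σ x ≠ 0 := by
  have h₀ : σ 0 = 0 := by simpa using hσ.2.1 0 0
  intro h
  rw [← hσ.2.2.2 x, h, h₀] at hx
  exact hx rfl

end IsConjLinearInvolution

end Semilinear

section ChevalleyPair

variable {L : Type*} [LieRing L] [LieAlgebra ℂ L] {H : LieSubalgebra ℂ L}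

lemma IsRootVector.add {α : H → ℂ} {x y : L} (hx : IsRootVector H α x)
    (hy : IsRootVector H α y) : IsRootVector H α (x + y) := fun h ↦ by
  rw [lie_add, hx, hy, smul_add]

lemma IsRootVector.smul {α : H → ℂ} {x : L} (hx : IsRootVector H α x) (z : ℂ) :
    IsRootVector H α (z • x) := fun h ↦ by
  rw [lie_smul, hx, smul_comm]

/-- A nonzero root space stable under a conjugate-linear involution contains a nonzero fixed
vector. -/
lemma IsConjLinearInvolution.exists_fixed_isRootVector {σ : L → L}
    (hσ : IsConjLinearInvolution σ) (hH : ∀ x ∈ H, σ x ∈ H) {α : H → ℂ}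
    (hα : sigmaStar H σ hH α = α) {x : L} (hx₀ : x ≠ 0) (hx : IsRootVector H α x) :
    ∃ e : L, e ≠ 0 ∧ IsRootVector H α e ∧ σ e = e := by
  have hσx : IsRootVector H α (σ x) := hα ▸ hσ.isRootVector hH hx
  by_cases h : x + σ x = 0
  · refine ⟨Complex.I • x, smul_ne_zero Complex.I_ne_zero hx₀, hx.smul _, ?_⟩
    rw [hσ.2.1, eq_neg_of_add_eq_zero_right h]
    simp
  · exact ⟨x + σ x, h, hx.add hσx, by rw [hσ.1, hσ.2.2.2, add_comm]⟩

/-- Opposite root vectors whose bracket is the Killing dual of the root. -/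
structure IsChevalleyPair (H : LieSubalgebra ℂ L) (α : H → ℂ) (p : L × L) : Prop where
  fst_ne_zero : p.1 ≠ 0
  snd_ne_zero : p.2 ≠ 0
  fst : IsRootVector H α p.1
  snd : IsRootVector H (-α) p.2
  lie : IsKillingDual H ⁅p.1, p.2⁆ α

lemma IsChevalleyPair.map [FiniteDimensional ℂ L] {σ : L → L} (hσ : IsConjLinearInvolution σ)
    (hH : ∀ x ∈ H, σ x ∈ H) {α : H → ℂ} {p : L × L} (hp : IsChevalleyPair H α p) :
    IsChevalleyPair H (sigmaStar H σ hH α) (p.map σ σ) where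
  fst_ne_zero := hσ.map_ne_zero hp.fst_ne_zero
  snd_ne_zero := hσ.map_ne_zero hp.snd_ne_zero
  fst := hσ.isRootVector hH hp.fst
  snd := IsConjLinearInvolution.sigmaStar_neg hH α ▸ hσ.isRootVector hH hp.snd
  lie := by
    rw [Prod.map_fst, Prod.map_snd, ← hσ.2.2.1]
    exact hσ.isKillingDual hH hp.lie

lemma IsKillingDual.midpoint {α : H → ℂ} {x y : L} (hx : IsKillingDual H x α)
    (hy : IsKillingDual H y α) : IsKillingDual H ((2⁻¹ : ℂ) • (x + y)) α := by
  refine ⟨H.smul_mem _ (H.add_mem hx.1 hy.1), fun h ↦ ?_⟩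
  rw [map_smul, map_add, LinearMap.smul_apply, LinearMap.add_apply, ← hx.2, ← hy.2, smul_eq_mul]
  ring

variable [FiniteDimensional ℂ L] [LieAlgebra.IsKilling ℂ L] [H.IsCartanSubalgebra]

lemma isRootVector_iff_mem_rootSpace {α : H → ℂ} {x : L} :
    IsRootVector H α x ↔ x ∈ LieAlgebra.rootSpace H α := by
  refine ⟨fun hx ↦ LieModule.weightSpace_le_genWeightSpace L α ?_, fun hx h ↦ ?_⟩
  · exact (LieModule.mem_weightSpace _ _).mpr hx
  · exact LieAlgebra.IsKilling.lie_eq_smul_of_mem_rootSpace hx h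

lemma exists_isChevalleyPair {α : H → ℂ} {e : L} (he₀ : e ≠ 0)
    (he : IsRootVector H α e) : ∃ f : L, IsChevalleyPair H α (e, f) := by
  have he' := isRootVector_iff_mem_rootSpace.mp he
  obtain ⟨y, hy, hey⟩ : ∃ y ∈ LieAlgebra.rootSpace H (-α), killingForm ℂ L e y ≠ 0 := by
    by_contra! h
    have := LieAlgebra.mem_ker_killingForm_of_mem_rootSpace_of_forall_rootSpace_neg ℂ L H he' h
    rw [LieAlgebra.IsKilling.ker_killingForm_eq_bot] at this
    exact he₀ this
  set f : L := (killingForm ℂ L e y)⁻¹ • y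
  have hf : f ∈ LieAlgebra.rootSpace H (-α) := Submodule.smul_mem _ _ hy
  have hef : killingForm ℂ L e f = 1 := by simp [f, hey]
  let w : LieModule.Weight ℂ H L :=
    ⟨α, fun h ↦ he₀ (by rw [LieAlgebra.rootSpace, h] at he'; exact he')⟩
  have hlie : ⁅e, f⁆ = ((LieAlgebra.IsKilling.cartanEquivDual H).symm w.toLinear : H) := by
    simpa [hef] using
      LieAlgebra.IsKilling.lie_eq_killingForm_smul_of_mem_rootSpace_of_mem_rootSpace_neg
        (α := w) he' hf
  refine ⟨f, he₀, ?_, he, isRootVector_iff_mem_rootSpace.mpr hf, ?_, fun h ↦ ?_⟩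
  · rintro h : f = 0
    simp [h] at hef
  · simp [hlie]
  · have := LieAlgebra.IsKilling.cartanEquivDual_apply_apply (K := ℂ) (L := L) (H := H)
      ((LieAlgebra.IsKilling.cartanEquivDual H).symm w.toLinear) h
    rw [LinearEquiv.apply_symm_apply] at this
    simp only [hlie]
    exact this

lemma IsConjLinearInvolution.exists_fixed_isChevalleyPair {σ : L → L}
    (hσ : IsConjLinearInvolution σ) (hH : ∀ x ∈ H, σ x ∈ H) {α : H → ℂ} (hα : IsRoot H α)
    (hfix : sigmaStar H σ hH α = α) : ∃ p, IsChevalleyPair H α p ∧ p.map σ σ = p := by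
  obtain ⟨hα₀, x, hx₀, hx⟩ := hα
  obtain ⟨e, he₀, he, hσe⟩ := hσ.exists_fixed_isRootVector hH hfix hx₀ hx
  obtain ⟨f, hf⟩ := exists_isChevalleyPair he₀ he
  have hf' := hf.map hσ hH
  rw [hfix, Prod.map_apply, hσe] at hf'
  have hlie : IsKillingDual H ⁅e, (2⁻¹ : ℂ) • (f + σ f)⁆ α := by
    rw [lie_smul, lie_add]
    exact hf.lie.midpoint hf'.lie
  refine ⟨(e, (2⁻¹ : ℂ) • (f + σ f)), ⟨he₀, ?_, he, (hf.snd.add hf'.snd).smul _, hlie⟩, ?_⟩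
  · rintro h : (2⁻¹ : ℂ) • (f + σ f) = 0
    refine hα₀ (funext fun k ↦ ?_)
    rw [hlie.2 k, h, lie_zero]
    simp
  · rw [Prod.map_apply, hσe, hσ.2.1, hσ.1, hσ.2.2.2, add_comm (σ f), map_inv₀, map_ofNat]

end ChevalleyPair

/-- if `σ` is a conjugate-linear involution preserving the Cartan subalgebra
`H` with `σ*(Δ) = Δ`, and `μ` is the restriction of `σ*` to `Δ`, then there is a choice of
elements `e_α ∈ 𝔤_α`, `e_{-α} ∈ 𝔤_{-α}` with `[e_α, e_{-α}] = h_α` such that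
`σ(e_α) = e_{μ(α)}` and `σ(e_{-α}) = e_{-μ(α)}` for all simple roots `α`. -/
theorem exists_chevalley_generators_varsigma
    (L : Type*) [LieRing L] [LieAlgebra ℂ L] [FiniteDimensional ℂ L]
    [LieAlgebra.IsSimple ℂ L]
    (H : LieSubalgebra ℂ L) [H.IsCartanSubalgebra]
    (Δ : Finset (H → ℂ)) (hΔ : IsBase H Δ)
    (σ : L → L) (hσ : IsConjLinearInvolution σ)
    (hH : ∀ x ∈ H, σ x ∈ H)
    (hstable : (sigmaStar H σ hH) '' (Δ : Set (H → ℂ)) = (Δ : Set (H → ℂ))) :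
    ∃ ep en : (H → ℂ) → L, ∀ α ∈ Δ,
      ep α ≠ 0 ∧ en α ≠ 0 ∧
      IsRootVector H α (ep α) ∧ IsRootVector H (-α) (en α) ∧
      IsKillingDual H ⁅ep α, en α⁆ α ∧
      σ (ep α) = ep (sigmaStar H σ hH α) ∧
      σ (en α) = en (sigmaStar H σ hH α) := by
  have hT : Function.Involutive (Prod.map σ σ) := fun p ↦
    Prod.ext (hσ.2.2.2 p.1) (hσ.2.2.2 p.2)
  have hS : Set.MapsTo (sigmaStar H σ hH) (Δ : Set (H → ℂ)) Δ :=
    Set.mapsTo_iff_image_subset.mpr hstable.subset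
  obtain ⟨g, hg⟩ := exists_equivariant_section (P := IsChevalleyPair H)
    (hσ.sigmaStar_involutive hH) hT hS (fun _ _ hp ↦ hp.map hσ hH)
    (fun α hα ↦ by
      obtain ⟨-, e, he₀, he⟩ := hΔ.1 α hα
      obtain ⟨f, hf⟩ := exists_isChevalleyPair he₀ he
      exact ⟨_, hf⟩)
    (fun α hα hfix ↦ hσ.exists_fixed_isChevalleyPair hH (hΔ.1 α hα) hfix) 0
  refine ⟨fun α ↦ (g α).1, fun α ↦ (g α).2, fun α hα ↦ ?_⟩
  obtain ⟨hp, h⟩ := hg α hα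
  exact ⟨hp.fst_ne_zero, hp.snd_ne_zero, hp.fst, hp.snd, hp.lie,
    congrArg Prod.fst h, congrArg Prod.snd h⟩
end

section
/- Let 𝔤₀ be an absolutely simple real Lie algebra. If r ∈ 𝔤₀ ⊗ 𝔤₀ is antisymmetric and invariant (x • r = 0 for all x ∈ 𝔤₀), then r = 0. -/
open scoped TensorProduct

/-- A simple Lie algebra over an algebraically closed field has no endomorphisms commuting with
the adjoint action other than scalars. -/
lemma LieAlgebra.IsSimple.exists_eq_smul_of_lie_comm {K L : Type*} [Field K] [IsAlgClosed K]
    [LieRing L] [LieAlgebra K L] [FiniteDimensional K L] [LieAlgebra.IsSimple K L]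
    (F : L →ₗ[K] L) (hF : ∀ z w : L, F ⁅z, w⁆ = ⁅z, F w⁆) :
    ∃ c : K, ∀ w, F w = c • w := by
  have : Nontrivial L := LieAlgebra.IsSimple.nontrivial K L
  obtain ⟨c, hc⟩ := Module.End.exists_eigenvalue F
  let I : LieIdeal K L :=
    { Module.End.eigenspace F c with
      lie_mem := by
        intro z w hw
        have hw : F w = c • w := Module.End.mem_eigenspace_iff.mp hw
        exact Module.End.mem_eigenspace_iff.mpr (by rw [hF, hw, lie_smul]) }
  have hI : I ≠ ⊥ := fun h => hc <| (LieSubmodule.toSubmodule_eq_bot I).mpr h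
  have hI : I = ⊤ := (LieAlgebra.IsSimple.eq_bot_or_eq_top I).resolve_left hI
  refine ⟨c, fun w => ?_⟩
  have hw : w ∈ I := hI ▸ LieSubmodule.mem_top w
  exact Module.End.mem_eigenspace_iff.mp hw

/-- The Killing form of an extension of scalars, on elements of the original Lie algebra. -/
lemma killingForm_one_tmul_one_tmul (k A : Type*) {L : Type*} [Field k] [Field A]
    [Algebra k A] [LieRing L] [LieAlgebra k L] [FiniteDimensional k L] (x y : L) :
    killingForm A (A ⊗[k] L) (1 ⊗ₜ x) (1 ⊗ₜ y) = algebraMap k A (killingForm k L x y) := by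
  rw [killingForm, LieModule.traceForm_baseChange, LinearMap.BilinForm.baseChange_tmul,
    mul_one, Algebra.algebraMap_eq_smul_one]

/-- The Killing form of a Lie algebra is nondegenerate if this holds after a field extension. -/
lemma killingForm_injective_of_baseChange (k A : Type*) {L : Type*} [Field k] [Field A]
    [Algebra k A] [LieRing L] [LieAlgebra k L] [FiniteDimensional k L]
    [LieAlgebra.IsKilling A (A ⊗[k] L)] :
    Function.Injective (killingForm k L) := by
  rw [← LinearMap.ker_eq_bot, LinearMap.ker_eq_bot']
  intro x hx
  have h1 : killingForm A (A ⊗[k] L) (1 ⊗ₜ x) = 0 := by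
    ext y
    simp [hx]
  have h2 : (1 : A) ⊗ₜ[k] x = 0 := by
    rw [← LinearMap.mem_ker, LieAlgebra.IsKilling.ker_killingForm_eq_bot] at h1
    simpa using h1
  exact (Module.FaithfullyFlat.one_tmul_eq_zero_iff k L x).mp h2

section KillingContraction

variable (k L : Type*) [Field k] [LieRing L] [LieAlgebra k L]

/-- The map sending `a ⊗ b` to the endomorphism `x ↦ κ(a, x) b`, with `κ` the Killing form. -/
noncomputable def killingContraction : L ⊗[k] L →ₗ[k] L →ₗ[k] L :=
  dualTensorHom k L L ∘ₗ (killingForm k L).rTensor L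

variable {k L}

@[simp]
lemma killingContraction_tmul_apply (a b x : L) :
    killingContraction k L (a ⊗ₜ b) x = killingForm k L a x • b := by
  simp [killingContraction]

lemma killingContraction_injective [FiniteDimensional k L]
    (h : Function.Injective (killingForm k L)) :
    Function.Injective (killingContraction k L) := by
  have h1 : Function.Injective (dualTensorHom k L L) :=
    (dualTensorHomEquiv k L L).injective
  exact h1.comp (Module.Flat.rTensor_preserves_injective_linearMap _ h)

lemma killingContraction_lie (x y : L) (t : L ⊗[k] L) :
    killingContraction k L ⁅x, t⁆ y =
      ⁅x, killingContraction k L t y⁆ - killingContraction k L t ⁅x, y⁆ := by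
  induction t with
  | zero => simp
  | add s t hs ht => simp only [lie_add, map_add, LinearMap.add_apply, hs, ht]; abel
  | tmul a b =>
    have h : killingForm k L ⁅x, a⁆ y = -killingForm k L a ⁅x, y⁆ := by
      rw [← lie_skew, map_neg, LinearMap.neg_apply, LieModule.traceForm_apply_lie_apply]
    simp only [TensorProduct.LieModule.lie_tmul_right, map_add, LinearMap.add_apply,
      killingContraction_tmul_apply, h, lie_smul, neg_smul]
    abel

lemma killingForm_killingContraction_comm (x y : L) (t : L ⊗[k] L) :
    killingForm k L (killingContraction k L (TensorProduct.comm k L L t) x) y =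
      killingForm k L x (killingContraction k L t y) := by
  induction t with
  | zero => simp
  | add s t hs ht => simp only [map_add, LinearMap.add_apply, hs, ht]
  | tmul a b =>
    simp only [TensorProduct.comm_tmul, killingContraction_tmul_apply, map_smul,
      LinearMap.smul_apply, smul_eq_mul]
    rw [LieModule.traceForm_comm k L L x b, mul_comm]

end KillingContraction

/-- if `𝔤₀` is an absolutely simple real Lie algebra (i.e. its
complexification `ℂ ⊗[ℝ] 𝔤₀` is a simple complex Lie algebra), then every antisymmetric
invariant element of `𝔤₀ ⊗ 𝔤₀` is zero. -/
theorem antisymmetric_invariant_eq_zero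
    (L₀ : Type*) [LieRing L₀] [LieAlgebra ℝ L₀] [FiniteDimensional ℝ L₀]
    [LieAlgebra.IsSimple ℂ (ℂ ⊗[ℝ] L₀)]
    (r : L₀ ⊗[ℝ] L₀)
    (hskew : TensorProduct.comm ℝ L₀ L₀ r = -r)
    (hinv : ∀ x : L₀, ⁅x, r⁆ = 0) :
    r = 0 := by
  have : LieAlgebra.IsKilling ℂ (ℂ ⊗[ℝ] L₀) :=
    inferInstance
  have hκ := killingForm_injective_of_baseChange ℝ ℂ (L := L₀)
  apply killingContraction_injective hκ
  rw [map_zero]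
  set f := killingContraction ℝ L₀ r
  have hcomm (x y : L₀) : f ⁅x, y⁆ = ⁅x, f y⁆ := by
    have h := killingContraction_lie x y r
    rw [hinv, map_zero, LinearMap.zero_apply] at h
    exact (sub_eq_zero.mp h.symm).symm
  have hadj (x y : L₀) : killingForm ℝ L₀ (f x) y = -killingForm ℝ L₀ x (f y) := by
    have h := killingForm_killingContraction_comm x y r
    rw [hskew] at h
    simpa [neg_eq_iff_eq_neg] using h
  obtain ⟨c, hc⟩ := LieAlgebra.IsSimple.exists_eq_smul_of_lie_comm (f.baseChange ℂ) <| by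
    intro z w
    induction z with
    | zero => simp
    | add z z' hz hz' => simp only [add_lie, map_add, hz, hz']
    | tmul a x =>
      induction w with
      | zero => simp
      | add w w' hw hw' => simp only [lie_add, map_add, hw, hw']
      | tmul b y => simp [LieAlgebra.ExtendScalars.bracket_tmul, hcomm]
  have hfc (x y : L₀) : (killingForm ℝ L₀ (f x) y : ℂ) = c * killingForm ℝ L₀ x y := by
    have h := congrArg (fun v => killingForm ℂ (ℂ ⊗[ℝ] L₀) v (1 ⊗ₜ y)) (hc (1 ⊗ₜ x))
    simpa [killingForm_one_tmul_one_tmul] using h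
  ext x
  apply hκ
  ext y
  have h1 := hfc x y
  have h2 := hfc y x
  rw [LieModule.traceForm_comm ℝ L₀ L₀ y x, LieModule.traceForm_comm ℝ L₀ L₀ (f y) x] at h2
  have h3 : (killingForm ℝ L₀ (f x) y : ℂ) = -killingForm ℝ L₀ x (f y) := by
    rw [hadj]; push_cast; rfl
  have h4 : (killingForm ℝ L₀ (f x) y : ℂ) = 0 := by linear_combination (h1 - h2 + h3) / 2
  simpa using h4
end

section
/- Let 𝔤₀ be an absolutely simple real Lie algebra and let δ : 𝔤₀ → 𝔤₀ ⊗ 𝔤₀ be a linear map such that δ(x) is antisymmetric for every x ∈ 𝔤₀ and δ([x,y]) = x • δ(y) − y • δ(x) for all x, y ∈ 𝔤₀. Then there exists a unique antisymmetric element r₀ ∈ 𝔤₀ ⊗ 𝔤₀ such that δ(x) = x • r₀ for all x ∈ 𝔤₀. -/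
open scoped TensorProduct

section BilinearForm

open LinearMap LinearMap.BilinForm

variable {K L P ι : Type*} [Field K] [LieRing L] [LieAlgebra K L]
  [AddCommGroup P] [Module K P] [Fintype ι] [DecidableEq ι]
  {Φ : LinearMap.BilinForm K L}

/-- The canonical tensor `∑ i, b i ⊗ b' i` attached to a basis `b` and its dual basis `b'` for an
invariant form is an invariant tensor. -/
theorem LinearMap.BilinForm.lieInvariant.sum_dualBasis_eq_zero (hinv : Φ.lieInvariant L)
    (hΦ : Φ.Nondegenerate) (hsymm : Φ.IsSymm) (b : Module.Basis ι K L)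
    (B : L →ₗ[K] L →ₗ[K] P) (x : L) :
    ∑ i, (B ⁅x, b i⁆ (Φ.dualBasis hΦ b i) + B (b i) ⁅x, Φ.dualBasis hΦ b i⁆) = 0 := by
  set d := Φ.dualBasis hΦ b with hd
  have hb (y : L) : y = ∑ j, Φ y (d j) • b j := by
    conv_lhs => rw [← b.sum_repr y]
    refine Finset.sum_congr rfl fun j _ ↦ ?_
    rw [← dualBasis_repr_apply hΦ, hd, dualBasis_dualBasis hΦ hsymm]
  have hd' (y : L) : y = ∑ j, Φ y (b j) • d j := by
    conv_lhs => rw [← d.sum_repr y]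
    simp [hd]
  have h₁ (i : ι) : B ⁅x, b i⁆ (d i) = ∑ j, Φ ⁅x, b i⁆ (d j) • B (b j) (d i) := by
    conv_lhs => rw [hb ⁅x, b i⁆]
    simp
  have h₂ (i : ι) : B (b i) ⁅x, d i⁆ = ∑ j, Φ ⁅x, d i⁆ (b j) • B (b i) (d j) := by
    conv_lhs => rw [hd' ⁅x, d i⁆]
    simp
  rw [Finset.sum_add_distrib, Finset.sum_congr rfl fun i _ ↦ h₁ i,
    Finset.sum_congr rfl fun i _ ↦ h₂ i, Finset.sum_comm, ← Finset.sum_add_distrib]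
  refine Finset.sum_eq_zero fun i _ ↦ ?_
  rw [← Finset.sum_add_distrib]
  refine Finset.sum_eq_zero fun j _ ↦ ?_
  rw [← add_smul, hinv x (d i) (b j), hsymm.eq, add_neg_cancel, zero_smul]

end BilinearForm

section Simple

variable {K L : Type*} [Field K] [LieRing L] [LieAlgebra K L] [LieAlgebra.IsSimple K L]

theorem LieAlgebra.IsSimple.lie_top_eq_top : ⁅(⊤ : LieIdeal K L), (⊤ : LieIdeal K L)⁆ = ⊤ := by
  refine (LieAlgebra.IsSimple.eq_bot_or_eq_top _).resolve_left fun h ↦ ?_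
  refine LieAlgebra.IsSimple.non_abelian K (L := L) ⟨fun x y ↦ ?_⟩
  have hxy := LieSubmodule.lie_mem_lie (LieSubmodule.mem_top (R := K) (L := L) x)
    (LieSubmodule.mem_top (R := K) (L := L) y)
  rwa [h, LieSubmodule.mem_bot] at hxy

theorem LieAlgebra.IsSimple.span_lie_eq_top :
    Submodule.span K {z : L | ∃ x y : L, ⁅x, y⁆ = z} = ⊤ := by
  have h := congrArg LieSubmodule.toSubmodule (lie_top_eq_top (K := K) (L := L))
  rw [LieSubmodule.lieIdeal_oper_eq_linear_span'] at h
  simpa using h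

variable {M : Type*} [AddCommGroup M] [Module K M] [LieRingModule L M] [LieModule K L M]

/-- The trace form of a nontrivial irreducible representation of a simple Lie algebra is
nondegenerate. -/
theorem LieModule.traceForm_nondegenerate_of_isIrreducible [CharZero K] [FiniteDimensional K L]
    [FiniteDimensional K M] [LieModule.IsIrreducible K L M] (hM : ¬ LieModule.IsTrivial L M) :
    (LieModule.traceForm K L M).Nondegenerate := by
  have hinv := LieModule.traceForm_lieInvariant K L M
  have hsymm := LieModule.traceForm_isSymm K L M
  let N := LieAlgebra.InvariantForm.orthogonal (L := L) (LieModule.traceForm K L M) hinv ⊤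
  have hN (y : L) : y ∈ N ↔ ∀ x, LieModule.traceForm K L M x y = 0 := by
    simp [N, LieAlgebra.InvariantForm.mem_orthogonal]
  rcases LieAlgebra.IsSimple.eq_bot_or_eq_top (R := K) (L := L) N with h | h
  · refine hsymm.isRefl.nondegenerate_iff_separatingRight.2 fun y hy ↦ ?_
    rw [← LieSubmodule.mem_bot (R := K) (L := L), ← h]
    exact (hN y).2 hy
  · have h0 : LieModule.traceForm K L M = 0 := by
      ext x y
      exact (hN y).1 (h ▸ LieSubmodule.mem_top y) x
    have hnil := LieModule.isNilpotent_derivedSeries_of_traceForm_eq_zero h0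
    have htop : LieAlgebra.derivedSeries K L 1 = ⊤ := by
      simpa using LieAlgebra.IsSimple.lie_top_eq_top (K := K) (L := L)
    have hnilL : LieModule.IsNilpotent L M := by
      rw [LieModule.isNilpotent_iff_forall' (R := K)] at hnil ⊢
      exact fun x ↦ hnil ⟨x, htop ▸ LieSubmodule.mem_top x⟩
    have : Nontrivial M := LieModule.nontrivial_of_isIrreducible K L M
    have := LieModule.nontrivial_max_triv_of_isNilpotent K L M
    have hmax := LieSubmodule.eq_top_of_isIrreducible K L M (LieModule.maxTrivSubmodule K L M)
    exact absurd ((LieModule.isTrivial_iff_max_triv_eq_top K L M).2 hmax) hM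

/-- A cocycle with values in an irreducible representation is a coboundary. The proof uses the
Casimir operator of the trace form. -/
theorem LieModule.exists_eq_lie_of_isIrreducible [CharZero K] [FiniteDimensional K L]
    [FiniteDimensional K M] [LieModule.IsIrreducible K L M] (f : L →ₗ[K] M)
    (hf : ∀ x y : L, f ⁅x, y⁆ = ⁅x, f y⁆ - ⁅y, f x⁆) : ∃ m : M, ∀ x : L, f x = ⁅x, m⁆ := by
  by_cases hM : LieModule.IsTrivial L M
  · have h0 : f = 0 := by
      refine LinearMap.ext_on (LieAlgebra.IsSimple.span_lie_eq_top (K := K) (L := L)) ?_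
      rintro _ ⟨x, y, rfl⟩
      simp [hf, LieModule.IsTrivial.trivial]
    exact ⟨0, by simp [h0]⟩
  have hΦ := LieModule.traceForm_nondegenerate_of_isIrreducible (K := K) hM
  have hinv := LieModule.traceForm_lieInvariant K L M
  have hsymm : (LieModule.traceForm K L M).IsSymm := ⟨LieModule.traceForm_comm K L M⟩
  set Φ := LieModule.traceForm K L M with hΦ_def
  let b := Module.finBasis K L
  let d := Φ.dualBasis hΦ b
  let ρ : L →ₗ[K] Module.End K M := (LieModule.toEnd K L M : L →ₗ[K] Module.End K M)
  let C : Module.End K M := ∑ i, ρ (b i) * ρ (d i)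
  have hC_apply (m : M) : C m = ∑ i, ⁅b i, ⁅d i, m⁆⁆ := by simp [C, ρ]
  have hC_lie (x : L) (m : M) : ⁅x, C m⁆ = C ⁅x, m⁆ := by
    have h := hinv.sum_dualBasis_eq_zero hΦ hsymm b
      ((LinearMap.mul K (Module.End K M)).compl₁₂ ρ ρ) x
    replace h := congrArg (fun T : Module.End K M ↦ T m) h
    simp only [LinearMap.compl₁₂_apply, LinearMap.mul_apply', LinearMap.sum_apply,
      LinearMap.add_apply, Module.End.mul_apply, LinearMap.zero_apply, ρ, LieHom.coe_toLinearMap,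
      LieModule.toEnd_apply_apply] at h
    rw [← sub_eq_zero, hC_apply, hC_apply, lie_sum, ← Finset.sum_sub_distrib, ← h]
    refine Finset.sum_congr rfl fun i _ ↦ ?_
    simp only [lie_lie, lie_sub, d]
    abel
  have hC_trace : LinearMap.trace K M C = (Module.finrank K L : K) := by
    have h (i) : LinearMap.trace K M (ρ (b i) * ρ (d i)) = 1 := by
      have := LinearMap.BilinForm.apply_dualBasis_right hΦ hsymm b i i
      rwa [if_pos rfl] at this
    simp [C, h]
  let N : LieSubmodule K L M :=
    { LinearMap.ker C with
      lie_mem := fun {x m} hm ↦ by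
        have hm' : C m = 0 := hm
        change C ⁅x, m⁆ = 0
        rw [← hC_lie, hm', lie_zero] }
  have hN : N = ⊥ := by
    refine (eq_bot_or_eq_top N).resolve_right fun h ↦ ?_
    have hC0 : C = 0 := by
      ext m
      exact (h ▸ LieSubmodule.mem_top m : m ∈ N)
    have := LieAlgebra.IsSimple.nontrivial K (L := L)
    rw [hC0, map_zero, eq_comm, Nat.cast_eq_zero] at hC_trace
    exact Module.finrank_pos.ne' hC_trace
  have hinj : Function.Injective C := by
    rw [← LinearMap.ker_eq_bot, eq_bot_iff]
    exact fun m hm ↦ (LieSubmodule.mem_bot (R := K) (L := L) m).1 (hN ▸ (show m ∈ N from hm))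
  obtain ⟨m, hm⟩ := LinearMap.surjective_of_injective hinj (∑ i, ⁅b i, f (d i)⁆)
  refine ⟨m, fun x ↦ hinj ?_⟩
  have h := hinv.sum_dualBasis_eq_zero hΦ hsymm b (ρ.compl₂ f) x
  rw [← hC_lie, hm, eq_comm, ← sub_eq_zero, hC_apply, lie_sum, ← Finset.sum_sub_distrib, ← h]
  refine Finset.sum_congr rfl fun i _ ↦ ?_
  simp only [LinearMap.compl₂_apply, ρ, LieHom.coe_toLinearMap, LieModule.toEnd_apply_apply, hf,
    lie_sub, lie_lie, d]
  abel

/-- **Whitehead's first lemma** for simple Lie algebras in characteristic zero: every cocycle with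
values in a finite-dimensional representation is a coboundary. -/
theorem LieModule.exists_eq_lie_of_cocycle {K L : Type*} [Field K] [CharZero K] [LieRing L]
    [LieAlgebra K L] [LieAlgebra.IsSimple K L] [FiniteDimensional K L] (M : Type*) [AddCommGroup M]
    [Module K M] [LieRingModule L M] [LieModule K L M] [FiniteDimensional K M] (f : L →ₗ[K] M)
    (hf : ∀ x y : L, f ⁅x, y⁆ = ⁅x, f y⁆ - ⁅y, f x⁆) : ∃ m : M, ∀ x : L, f x = ⁅x, m⁆ := by
  induction hn : Module.finrank K M using Nat.strong_induction_on generalizing M with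
  | _ n ih =>
  subst hn
  rcases subsingleton_or_nontrivial M with _ | _
  · exact ⟨0, fun x ↦ Subsingleton.elim _ _⟩
  by_cases hirr : LieModule.IsIrreducible K L M
  · exact LieModule.exists_eq_lie_of_isIrreducible f hf
  obtain ⟨N, hbot, htop⟩ : ∃ N : LieSubmodule K L M, N ≠ ⊥ ∧ N ≠ ⊤ := by
    contrapose! hirr
    exact LieModule.IsIrreducible.mk hirr
  have hN : N.toSubmodule ≠ ⊥ := by simpa using hbot
  have hN' : N.toSubmodule ≠ ⊤ := by simpa using htop
  obtain ⟨q, hq⟩ := ih (Module.finrank K (M ⧸ N)) (by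
      have := N.toSubmodule.finrank_quotient_add_finrank
      have := Submodule.one_le_finrank_iff.2 hN
      change Module.finrank K (M ⧸ N.toSubmodule) < _
      omega) (M ⧸ N)
    ((LieSubmodule.Quotient.mk' N : M →ₗ[K] M ⧸ N) ∘ₗ f) (fun x y ↦ by
      simp only [LinearMap.comp_apply, hf, map_sub]
      rfl) rfl
  obtain ⟨m, rfl⟩ := LieSubmodule.Quotient.surjective_mk' N q
  have hmem (x : L) : f x - ⁅x, m⁆ ∈ N := by
    rw [← LieSubmodule.Quotient.mk_eq_zero, map_sub, sub_eq_zero, LieModuleHom.map_lie]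
    exact hq x
  let g : L →ₗ[K] N := LinearMap.codRestrict N.toSubmodule
    (f - (LieModule.toEnd K L M : L →ₗ[K] Module.End K M).flip m) hmem
  have hg (x : L) : (g x : M) = f x - ⁅x, m⁆ := rfl
  obtain ⟨n, hn⟩ := ih (Module.finrank K N) (Submodule.finrank_lt hN') N g (fun x y ↦ by
    ext
    simp only [hg, hf, LieSubmodule.coe_sub, LieSubmodule.coe_bracket, lie_sub, lie_lie]
    abel) rfl
  refine ⟨m + n, fun x ↦ ?_⟩
  rw [lie_add, ← LieSubmodule.coe_bracket, ← hn, hg]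
  abel

/-- A simple Lie algebra in characteristic zero has no nonzero antisymmetric
invariant tensor. -/
theorem LieAlgebra.IsSimple.eq_zero_of_antisymm_of_lie_eq_zero [CharZero K] [FiniteDimensional K L]
    {r : L ⊗[K] L} (hr : TensorProduct.comm K L L r = -r) (hinv : ∀ x : L, ⁅x, r⁆ = 0) :
    r = 0 := by
  let κ := killingForm K L
  let e : L ≃ₗ[K] Module.Dual K L :=
    LinearMap.BilinForm.toDual κ (LieAlgebra.IsKilling.killingForm_nondegenerate K L)
  let F : L ⊗[K] L ≃ₗ[K] Module.Dual K (L ⊗[K] L) :=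
    TensorProduct.congr e e ≪≫ₗ TensorProduct.dualDistribEquiv K L L
  have hF (a b y z : L) : F (a ⊗ₜ b) (y ⊗ₜ z) = κ a y * κ b z := rfl
  have hκ (x y z : L) : κ ⁅x, y⁆ z = -κ y ⁅x, z⁆ := LieModule.traceForm_lieInvariant K L L x y z
  have hF_lie (s : L ⊗[K] L) (x y z : L) :
      F ⁅x, s⁆ (y ⊗ₜ z) = -F s (⁅x, y⁆ ⊗ₜ z) - F s (y ⊗ₜ ⁅x, z⁆) := by
    induction s with
    | zero => simp
    | tmul a b =>
      simp only [TensorProduct.LieModule.lie_tmul_right, map_add, LinearMap.add_apply, hF, hκ]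
      ring
    | add s t hs ht =>
      simp only [lie_add, map_add, LinearMap.add_apply, hs, ht]
      ring
  have hF_comm (s : L ⊗[K] L) (y z : L) :
      F (TensorProduct.comm K L L s) (y ⊗ₜ z) = F s (z ⊗ₜ y) := by
    induction s with
    | zero => simp
    | tmul a b => simp [hF, mul_comm]
    | add s t hs ht => simp [hs, ht]
  have hskew (y z : L) : F r (z ⊗ₜ y) = -F r (y ⊗ₜ z) := by
    rw [← hF_comm, hr, map_neg, LinearMap.neg_apply]
  have hassoc (x y z : L) : F r (⁅x, y⁆ ⊗ₜ z) = F r (x ⊗ₜ ⁅y, z⁆) := by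
    have h := hF_lie r y x z
    rw [hinv, map_zero, LinearMap.zero_apply] at h
    rw [← lie_skew, TensorProduct.neg_tmul, map_neg]
    linear_combination -h
  have hcyc (x y z : L) : F r (⁅x, y⁆ ⊗ₜ z) = -F r (⁅y, z⁆ ⊗ₜ x) := by rw [hassoc, hskew]
  have hzero (x y z : L) : F r (⁅x, y⁆ ⊗ₜ z) = 0 := by
    rw [← self_eq_neg]
    conv_lhs => rw [hcyc, hcyc, hcyc, neg_neg]
  rw [← F.map_eq_zero_iff]
  refine TensorProduct.ext ?_
  refine LinearMap.ext_on (LieAlgebra.IsSimple.span_lie_eq_top (K := K) (L := L)) ?_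
  rintro _ ⟨x, y, rfl⟩
  ext z
  exact hzero x y z

/-- A Lie algebra is simple if it becomes simple after an extension of scalars. -/
theorem LieAlgebra.IsSimple.of_baseChange (K A L : Type*) [Field K] [Field A] [Algebra K A]
    [LieRing L] [LieAlgebra K L] [LieAlgebra.IsSimple A (A ⊗[K] L)] : LieAlgebra.IsSimple K L where
  eq_bot_or_eq_top I := by
    refine (LieAlgebra.IsSimple.eq_bot_or_eq_top (R := A) (I.baseChange A)).imp ?_ ?_ <;>
    · intro h
      rw [← LieSubmodule.toSubmodule_inj]
      apply Submodule.baseChange_injective (A := A)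
      simpa using congrArg LieSubmodule.toSubmodule h
  non_abelian h := by
    refine LieAlgebra.IsSimple.non_abelian A (L := A ⊗[K] L) ⟨fun x y ↦ ?_⟩
    induction x with
    | zero => simp
    | add x x' hx hx' => rw [add_lie, hx, hx', add_zero]
    | tmul a u =>
      induction y with
      | zero => simp
      | add y y' hy hy' => rw [lie_add, hy, hy', add_zero]
      | tmul c v =>
        rw [LieAlgebra.ExtendScalars.bracket_tmul, LieModule.IsTrivial.trivial,
          TensorProduct.tmul_zero]

end Simple

theorem TensorProduct.LieModule.comm_lie {R L M : Type*} [CommRing R] [LieRing L] [LieAlgebra R L]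
    [AddCommGroup M] [Module R M] [LieRingModule L M] [LieModule R L M] (x : L) (r : M ⊗[R] M) :
    TensorProduct.comm R M M ⁅x, r⁆ = ⁅x, TensorProduct.comm R M M r⁆ := by
  induction r with
  | zero => simp
  | tmul a b => simp [add_comm]
  | add s t hs ht => simp only [lie_add, map_add, hs, ht]

/-- Whitehead's lemma argument: if `𝔤₀` is an absolutely simple real Lie
algebra and `δ : 𝔤₀ → 𝔤₀ ⊗ 𝔤₀` is a 1-cocycle with antisymmetric values, then `δ` is the
coboundary of a unique antisymmetric element `r₀ ∈ 𝔤₀ ⊗ 𝔤₀`. -/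
theorem cocycle_is_coboundary_of_unique_antisymmetric
    (L₀ : Type*) [LieRing L₀] [LieAlgebra ℝ L₀] [FiniteDimensional ℝ L₀]
    [LieAlgebra.IsSimple ℂ (ℂ ⊗[ℝ] L₀)]
    (δ : L₀ →ₗ[ℝ] L₀ ⊗[ℝ] L₀)
    (hskew : ∀ x : L₀, TensorProduct.comm ℝ L₀ L₀ (δ x) = -(δ x))
    (hcocycle : ∀ x y : L₀, δ ⁅x, y⁆ = ⁅x, δ y⁆ - ⁅y, δ x⁆) :
    ∃! r₀ : L₀ ⊗[ℝ] L₀,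
      TensorProduct.comm ℝ L₀ L₀ r₀ = -r₀ ∧ ∀ x : L₀, δ x = ⁅x, r₀⁆ := by
  have := LieAlgebra.IsSimple.of_baseChange ℝ ℂ L₀
  obtain ⟨r, hr⟩ := LieModule.exists_eq_lie_of_cocycle (L₀ ⊗[ℝ] L₀) δ hcocycle
  refine ⟨(2⁻¹ : ℝ) • (r - TensorProduct.comm ℝ L₀ L₀ r), ⟨?_, fun x ↦ ?_⟩, ?_⟩
  · rw [map_smul, map_sub, ← smul_neg, neg_sub]
    simp
  · rw [lie_smul, lie_sub, ← TensorProduct.LieModule.comm_lie, ← hr, hskew, sub_neg_eq_add,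
      ← two_smul ℝ, inv_smul_smul₀ two_ne_zero]
  · rintro s ⟨hs, hs'⟩
    rw [← sub_eq_zero]
    apply LieAlgebra.IsSimple.eq_zero_of_antisymm_of_lie_eq_zero (K := ℝ)
    · simp only [map_sub, map_smul, hs, TensorProduct.comm_comm]
      module
    · intro x
      rw [lie_sub, ← hs', lie_smul, lie_sub, ← TensorProduct.LieModule.comm_lie, ← hr, hskew,
        sub_neg_eq_add, ← two_smul ℝ, inv_smul_smul₀ two_ne_zero, sub_self]
end

section
/- Let Δ be a finite set, Γ₁, Γ₂ ⊆ Δ, T : Γ₁ → Γ₂ a bijection satisfying the nilpotency condition, and ≺ the associated relation on Δ. Let μ : Δ → Δ be a bijection with μ ∘ μ = id such that for all α, β ∈ Δ: α ≺ β if and only if μ(α) ≺ μ(β). Then μ(Γ₁) = Γ₁, μ(Γ₂) = Γ₂, and T(μ(α)) = μ(T(α)) for all α ∈ Γ₁ (that is, the triple (Γ₁, Γ₂, T) is μ-stable). -/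
/-- The partial order associated to a Belavin-Drinfeld triple: `α ≺ β` iff `β = Tⁿ(α)`
for some `n ≥ 1` with all intermediate iterates staying in `Γ₁`. -/
def BDprec {Δ : Type*} (Γ₁ : Set Δ) (T : Δ → Δ) (α β : Δ) : Prop :=
  ∃ n : ℕ, 1 ≤ n ∧ (∀ k < n, T^[k] α ∈ Γ₁) ∧ T^[n] α = β

/-- The nilpotency condition of a Belavin-Drinfeld triple: every `T`-orbit eventually
leaves `Γ₁`. -/
def BDnilpotent {Δ : Type*} (Γ₁ : Set Δ) (T : Δ → Δ) : Prop :=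
  ∀ α ∈ Γ₁, ∃ n : ℕ, 1 ≤ n ∧ (∀ k < n, T^[k] α ∈ Γ₁) ∧ T^[n] α ∉ Γ₁

theorem BDprec.trans {Δ : Type*} {Γ₁ : Set Δ} {T : Δ → Δ} {α β γ : Δ}
    (h₁ : BDprec Γ₁ T α β) (h₂ : BDprec Γ₁ T β γ) : BDprec Γ₁ T α γ := by
  obtain ⟨m, hm, hmem, rfl⟩ := h₁
  obtain ⟨n, hn, hmem', rfl⟩ := h₂
  refine ⟨n + m, by lia, fun k hk => ?_, Function.iterate_add_apply T n m α⟩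
  rcases lt_or_ge k m with h | h
  · exact hmem k h
  · have := hmem' (k - m) (by lia)
    rwa [← Function.iterate_add_apply, Nat.sub_add_cancel h] at this

theorem BDprec.left_mem {Δ : Type*} {Γ₁ : Set Δ} {T : Δ → Δ} {α β : Δ}
    (h : BDprec Γ₁ T α β) : α ∈ Γ₁ := by
  obtain ⟨n, hn, hmem, -⟩ := h
  exact hmem 0 hn

theorem bdprec_apply_of_mem {Δ : Type*} {Γ₁ : Set Δ} {T : Δ → Δ} {α : Δ}
    (h : α ∈ Γ₁) : BDprec Γ₁ T α (T α) := by
  refine ⟨1, le_rfl, fun k hk => ?_, rfl⟩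
  obtain rfl : k = 0 := by lia
  exact h

/-- `T α` is the least element strictly above `α`. -/
theorem BDprec.apply_eq_or_bdprec {Δ : Type*} {Γ₁ : Set Δ} {T : Δ → Δ} {α β : Δ}
    (h : BDprec Γ₁ T α β) : T α = β ∨ BDprec Γ₁ T (T α) β := by
  obtain ⟨n, hn, hmem, rfl⟩ := h
  obtain ⟨n, rfl⟩ := Nat.exists_eq_add_of_le' hn
  rcases Nat.eq_zero_or_pos n with rfl | h
  · exact Or.inl rfl
  · exact Or.inr ⟨n, h, fun k hk => hmem (k + 1) (by lia), rfl⟩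

theorem BDnilpotent.not_bdprec_self {Δ : Type*} {Γ₁ : Set Δ} {T : Δ → Δ}
    (hnil : BDnilpotent Γ₁ T) (α : Δ) : ¬ BDprec Γ₁ T α α := by
  intro h
  obtain ⟨m, -, -, hm⟩ := hnil α h.left_mem
  obtain ⟨n, hn, hmem, hper⟩ := h
  have hper' : Function.IsPeriodicPt T n α := hper
  rw [← hper'.iterate_mod_apply m] at hm
  exact hm (hmem _ (Nat.mod_lt _ hn))

theorem Function.Involutive.image_eq_of_mapsTo {Δ : Type*} {μ : Δ → Δ}
    (hμ : Function.Involutive μ) {s : Set Δ} (h : Set.MapsTo μ s s) : μ '' s = s :=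
  h.image_subset.antisymm fun x hx => ⟨μ x, h hx, hμ x⟩

/-- if `μ` is an involution of `Δ` with `α ≺ β ↔ μ(α) ≺ μ(β)`, then the
BD-triple `(Γ₁, Γ₂, T)` is `μ`-stable: `μ(Γ₁) = Γ₁`, `μ(Γ₂) = Γ₂` and `T ∘ μ = μ ∘ T`
on `Γ₁`. -/
theorem bd_triple_mu_stable
    (Δ : Type*) [Fintype Δ] (Γ₁ Γ₂ : Set Δ) (T : Δ → Δ)
    (hT : Set.BijOn T Γ₁ Γ₂)
    (hnil : BDnilpotent Γ₁ T)
    (μ : Δ → Δ) (hμinv : Function.Involutive μ)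
    (hprec : ∀ α β : Δ, BDprec Γ₁ T α β ↔ BDprec Γ₁ T (μ α) (μ β)) :
    μ '' Γ₁ = Γ₁ ∧ μ '' Γ₂ = Γ₂ ∧ ∀ α ∈ Γ₁, T (μ α) = μ (T α) := by
  have hmaps : Set.MapsTo μ Γ₁ Γ₁ := fun α hα =>
    ((hprec _ _).1 (bdprec_apply_of_mem hα)).left_mem
  have hcomm : ∀ α ∈ Γ₁, T (μ α) = μ (T α) := by
    intro α hα
    have h₁ : BDprec Γ₁ T α (μ (T (μ α))) := by
      rw [hprec, hμinv]
      exact bdprec_apply_of_mem (hmaps hα)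
    have h₂ : BDprec Γ₁ T (μ α) (μ (T α)) := (hprec _ _).1 (bdprec_apply_of_mem hα)
    rcases h₁.apply_eq_or_bdprec with h | h
    · rw [h, hμinv]
    rcases h₂.apply_eq_or_bdprec with h' | h'
    · exact h'
    rw [hprec, hμinv] at h
    exact absurd (h'.trans h) (hnil.not_bdprec_self _)
  refine ⟨hμinv.image_eq_of_mapsTo hmaps, hμinv.image_eq_of_mapsTo ?_, hcomm⟩
  intro β hβ
  obtain ⟨α, hα, rfl⟩ := hT.surjOn hβ
  rw [← hcomm α hα]
  exact hT.mapsTo (hmaps hα)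
end

section
/- Let Δ be a finite set, Γ₁, Γ₂ ⊆ Δ, T : Γ₁ → Γ₂ a bijection satisfying the nilpotency condition, and ≺ the associated relation on Δ. Let μ : Δ → Δ be a bijection with μ ∘ μ = id such that for all α, β ∈ Δ: α ≺ β if and only if μ(β) ≺ μ(α). Then μ(Γ₁) = Γ₂, μ(Γ₂) = Γ₁, and μ(T(α)) = T⁻¹(μ(α)) for all α ∈ Γ₁ (that is, the triple (Γ₁, Γ₂, T) is μ-antistable). -/
namespace BDprec

variable {Δ : Type*} {Γ₁ : Set Δ} {T : Δ → Δ} {α β γ : Δ}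

theorem of_mem (h : α ∈ Γ₁) : BDprec Γ₁ T α (T α) :=
  ⟨1, le_rfl, fun k hk => by rwa [Nat.lt_one_iff.1 hk], rfl⟩

theorem mem_left (h : BDprec Γ₁ T α β) : α ∈ Γ₁ := by
  obtain ⟨n, hn, hk, -⟩ := h
  exact hk 0 hn

theorem exists_apply_eq (h : BDprec Γ₁ T α β) : ∃ δ ∈ Γ₁, T δ = β := by
  obtain ⟨n, hn, hk, rfl⟩ := h
  obtain ⟨m, rfl⟩ : ∃ m, n = m + 1 := ⟨n - 1, by omega⟩
  exact ⟨T^[m] α, hk m m.lt_succ_self, (Function.iterate_succ_apply' T m α).symm⟩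

theorem apply_eq_or (h : BDprec Γ₁ T α β) : T α = β ∨ BDprec Γ₁ T (T α) β := by
  obtain ⟨n, hn, hk, rfl⟩ := h
  obtain ⟨m, rfl⟩ : ∃ m, n = m + 1 := ⟨n - 1, by omega⟩
  rcases Nat.eq_zero_or_pos m with rfl | hm
  · exact Or.inl rfl
  · exact Or.inr ⟨m, hm, fun k hkm => hk (k + 1) (by omega), rfl⟩

theorem trans_s9 (h : BDprec Γ₁ T α β) (h' : BDprec Γ₁ T β γ) : BDprec Γ₁ T α γ := by
  obtain ⟨n, hn, hk, rfl⟩ := h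
  obtain ⟨m, hm, hk', rfl⟩ := h'
  refine ⟨m + n, by omega, fun k hkmn => ?_, Function.iterate_add_apply T m n α⟩
  rcases lt_or_ge k n with hlt | hge
  · exact hk k hlt
  · have := hk' (k - n) (by omega)
    rwa [← Function.iterate_add_apply, Nat.sub_add_cancel hge] at this

theorem irrefl (hnil : BDnilpotent Γ₁ T) (α : Δ) : ¬ BDprec Γ₁ T α α := by
  intro h
  obtain ⟨m, -, -, hm⟩ := hnil α h.mem_left
  obtain ⟨n, hn, hk, hper⟩ := h
  have hmod : T^[m % n] α = T^[m] α := Function.IsPeriodicPt.iterate_mod_apply hper m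
  exact hm (hmod ▸ hk (m % n) (Nat.mod_lt m hn))

end BDprec

/-- if `μ` is an involution of `Δ` with `α ≺ β ↔ μ(β) ≺ μ(α)`, then the
BD-triple `(Γ₁, Γ₂, T)` is `μ`-antistable: `μ(Γ₁) = Γ₂`, `μ(Γ₂) = Γ₁` and
`μ(T(α)) = T⁻¹(μ(α))` for all `α ∈ Γ₁` (i.e. `μ(T α)` lies in `Γ₁` and is mapped by `T`
to `μ(α)`). -/
theorem bd_triple_mu_antistable
    (Δ : Type*) [Fintype Δ] (Γ₁ Γ₂ : Set Δ) (T : Δ → Δ)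
    (hT : Set.BijOn T Γ₁ Γ₂)
    (hnil : BDnilpotent Γ₁ T)
    (μ : Δ → Δ) (hμinv : Function.Involutive μ)
    (hprec : ∀ α β : Δ, BDprec Γ₁ T α β ↔ BDprec Γ₁ T (μ β) (μ α)) :
    μ '' Γ₁ = Γ₂ ∧ μ '' Γ₂ = Γ₁ ∧
      ∀ α ∈ Γ₁, μ (T α) ∈ Γ₁ ∧ T (μ (T α)) = μ α := by
  have hrev : ∀ {α β : Δ}, BDprec Γ₁ T α β → BDprec Γ₁ T (μ β) (μ α) := (hprec _ _).1
  have h₁₂ : ∀ α ∈ Γ₁, μ α ∈ Γ₂ := fun α hα => by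
    obtain ⟨δ, hδ, h⟩ := (hrev (BDprec.of_mem hα)).exists_apply_eq
    exact h ▸ hT.mapsTo hδ
  have h₂₁ : ∀ β ∈ Γ₂, μ β ∈ Γ₁ := fun β hβ => by
    obtain ⟨α, hα, rfl⟩ := hT.surjOn hβ
    exact (hrev (BDprec.of_mem hα)).mem_left
  refine ⟨?_, ?_, fun α hα => ?_⟩
  · exact (Set.image_subset_iff.2 h₁₂).antisymm fun β hβ => ⟨μ β, h₂₁ β hβ, hμinv β⟩
  · exact (Set.image_subset_iff.2 h₂₁).antisymm fun α hα => ⟨μ α, h₁₂ α hα, hμinv α⟩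
  · have hmem : μ (T α) ∈ Γ₁ := h₂₁ _ (hT.mapsTo hα)
    refine ⟨hmem, (hrev (BDprec.of_mem hα)).apply_eq_or.resolve_right fun hlt => ?_⟩
    have hlow := hrev hlt
    have hupp := hrev (BDprec.of_mem (T := T) hmem)
    rw [hμinv] at hlow hupp
    rcases hlow.apply_eq_or with heq | h
    · exact BDprec.irrefl hnil (T α) (by rwa [← heq] at hupp)
    · exact BDprec.irrefl hnil (T α) (h.trans_s9 hupp)
end

section
/- Let Δ be a finite set, μ : Δ → Δ a map with μ ∘ μ = id, and c : Δ → ℂ∖{0} a function satisfying c(α) · conj(c(μ(α))) = 1 for all α ∈ Δ. Then there exists a function d : Δ → ℂ∖{0} such that c(α) = conj(d(α))⁻¹ · d(μ(α)) for all α ∈ Δ. -/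
/-- if `μ` is an involution of a finite set `Δ` and `c : Δ → ℂ∖{0}`
satisfies `c(α) · conj(c(μ(α))) = 1`, then `c(α) = conj(d(α))⁻¹ · d(μ(α))` for some
function `d : Δ → ℂ∖{0}`. -/
theorem exists_rescaling
    (Δ : Type*) [Fintype Δ] (μ : Δ → Δ) (hμ : μ ∘ μ = id)
    (c : Δ → ℂ) (hc0 : ∀ α, c α ≠ 0)
    (hc : ∀ α, c α * (starRingEnd ℂ) (c (μ α)) = 1) :
    ∃ d : Δ → ℂ, (∀ α, d α ≠ 0) ∧
      ∀ α, c α = ((starRingEnd ℂ) (d α))⁻¹ * d (μ α) := by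
  have hμμ : ∀ α, μ (μ α) = α := congrFun hμ
  have hneg : ∀ α, c (μ α) = -1 → c α = -1 := by
    intro α h
    have h1 := hc α
    rw [h, map_neg, map_one] at h1
    linear_combination -h1
  have hd0 : ∀ α, (if c (μ α) = -1 then Complex.I else 1 + c (μ α)) ≠ 0 := by
    intro α
    split_ifs with h
    · exact Complex.I_ne_zero
    · exact fun h0 => h (by linear_combination h0)
  refine ⟨fun α => if c (μ α) = -1 then Complex.I else 1 + c (μ α), hd0, fun α => ?_⟩
  rw [eq_inv_mul_iff_mul_eq₀ ((map_ne_zero (starRingEnd ℂ)).mpr (hd0 α))]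
  simp only [hμμ]
  by_cases h : c (μ α) = -1
  · simp [h, hneg α h]
  · have h' : c α ≠ -1 := fun hα => h (hneg (μ α) (by rw [hμμ, hα]))
    rw [if_neg h, if_neg h', map_add, map_one]
    linear_combination hc α
end
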